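/- arXiv:math/0306057 — 2 statements merged into one kernel-verified Lean document; each statement's English description precedes it below -/
import Mathlib

section
/- Let k ≥ 1, let c(i,j) be integers for 1 ≤ i < j ≤ k with c(i,i) := 1, and fix w = w_1…w_k ∈ {0,1}^k. Let σ(w) := { ∑_{j=1}^k λ_j a_{j,w_j} : λ_j ≥ 0 } ⊆ ℝ^k. Then the dual cone of σ(w), namely { x ∈ ℝ^k : ⟨x, y⟩ ≥ 0 for all y ∈ σ(w) }, equals { ∑_{j=1}^k μ_j υ_{j,w_j} : μ_j ≥ 0 }. -/
/-- The upper-triangular matrix `C(I)` with `(r,s)` entry `c i_r i_s` for `r ≤ s`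
(and `0` below the diagonal), where `i_1 < … < i_m` lists the elements of `I`. -/
noncomputable def CofSet (c : ℕ → ℕ → ℤ) (I : Finset ℕ) : Matrix (Fin I.card) (Fin I.card) ℤ :=
  Matrix.of fun r s =>
    if (r : ℕ) ≤ (s : ℕ) then c (I.orderIsoOfFin rfl r).1 (I.orderIsoOfFin rfl s).1 else 0

/-- The Bott number `b(I)` of a subset `I`: the top-right entry of `B(I) = -C(I)⁻¹`. -/
noncomputable def bottOfSet (c : ℕ → ℕ → ℤ) (I : Finset ℕ) : ℤ :=
  if h : 0 < I.card then (-(CofSet c I)⁻¹) ⟨0, h⟩ ⟨I.card - 1, by omega⟩ else 0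

/-- The `m`-th coordinate (1-based) of the vector `a_{j, w_j} ∈ ℝ^k`:
`a_{j,0} = e_j` and `a_{j,1} = ∑_{m=j}^{k} b j m • e_m` (recall `b j m = 0` for `m < j`). -/
def aVec (b : ℕ → ℕ → ℤ) (w : ℕ → Bool) (j m : ℕ) : ℝ :=
  if w j then (b j m : ℝ) else if m = j then 1 else 0

/-- The `m`-th coordinate (1-based) of the vector
`υ_{j, w_j} = (-1)^{w_j} (e_j + ∑_{i ∈ 𝕀(j)} b({i} ∪ 𝕆_i^j ∪ {j}) • e_i)`,
where `𝕀(j) = {l : 1 ≤ l < j, w l = 1}` and `𝕆_i^j = {l : i < l < j, w l = 0}`. -/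
noncomputable def upsilonVec (c : ℕ → ℕ → ℤ) (w : ℕ → Bool) (j m : ℕ) : ℝ :=
  (if w j then (-1 : ℝ) else 1) *
    ((if m = j then 1 else 0) +
      if 1 ≤ m ∧ m < j ∧ w m = true then
        (bottOfSet c (insert m (((Finset.Ioo m j).filter fun l => w l = false) ∪ {j})) : ℝ)
      else 0)


/-- auxiliary numbers -/
def betaAux (c : ℕ → ℕ → ℤ) (w : ℕ → Bool) (j l : ℕ) : ℤ :=
  if h : l < j then
    -∑ p ∈ (Finset.Ioc l j).attach,
      if w p.1 = false ∨ p.1 = j then c l p.1 * betaAux c w j p.1 else 0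
  else -1
termination_by j - l
decreasing_by
  have := Finset.mem_Ioc.1 p.2
  omega

theorem betaAux_self (c : ℕ → ℕ → ℤ) (w : ℕ → Bool) (j : ℕ) : betaAux c w j j = -1 := by
  rw [betaAux]; simp

theorem betaAux_lt (c : ℕ → ℕ → ℤ) (w : ℕ → Bool) (j l : ℕ) (h : l < j) :
    betaAux c w j l = -∑ p ∈ Finset.Ioc l j,
      if w p = false ∨ p = j then c l p * betaAux c w j p else 0 := by
  rw [betaAux, dif_pos h]
  congr 1
  exact Finset.sum_attach (Finset.Ioc l j)
    (fun p => if w p = false ∨ p = j then c l p * betaAux c w j p else 0)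

theorem sum_fin_Icc {M : Type*} [AddCommMonoid M] (k : ℕ) (f : ℕ → M) :
    ∑ m : Fin k, f ((m : ℕ) + 1) = ∑ m ∈ Finset.Icc 1 k, f m := by
  rw [Fin.sum_univ_eq_sum_range (fun m => f (m + 1)) k, Finset.range_eq_Ico,
    Finset.sum_Ico_add' f 0 k 1]
  rfl

theorem bott_eq (c : ℕ → ℕ → ℤ) (I : Finset ℕ) (m j : ℕ) (hm : m ∈ I) (hj : j ∈ I)
    (hmin : ∀ l ∈ I, m ≤ l) (hmax : ∀ l ∈ I, l ≤ j) (hdiag : ∀ l ∈ I, c l l = 1)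
    (f : ℕ → ℤ) (fj : f j = -1)
    (hf : ∀ l ∈ I, l < j → f l = -∑ p ∈ I with l < p, c l p * f p) :
    bottOfSet c I = f m := by
  have hcard : 0 < I.card := Finset.card_pos.2 ⟨m, hm⟩
  set e := I.orderIsoOfFin rfl with he
  have hdet : (CofSet c I).det = 1 := by
    rw [Matrix.det_of_isUpperTriangular]
    · apply Finset.prod_eq_one
      intro i _
      simp only [CofSet, Matrix.of_apply, le_refl, if_true]
      exact hdiag _ (e i).2
    · intro a b hab
      have : (b : ℕ) < a := hab
      simp only [CofSet, Matrix.of_apply]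
      rw [if_neg (by omega)]
  have hmem : ∀ r, (e r).1 ∈ I := fun r => (e r).2
  have hlast : (e ⟨I.card - 1, by omega⟩).1 = j := by
    apply le_antisymm (hmax _ (hmem _))
    have h1 : e.symm ⟨j, hj⟩ ≤ ⟨I.card - 1, by omega⟩ := by
      rw [Fin.le_def]; have := (e.symm ⟨j, hj⟩).2; simp only; omega
    have := e.monotone h1
    rw [e.apply_symm_apply] at this
    exact this
  have hfirst : (e ⟨0, hcard⟩).1 = m := by
    apply le_antisymm _ (hmin _ (hmem _))
    have h1 : ⟨0, hcard⟩ ≤ e.symm ⟨m, hm⟩ := by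
      rw [Fin.le_def]; simp
    have := e.monotone h1
    rw [e.apply_symm_apply] at this
    exact this
  have hmul : (CofSet c I).mulVec (fun r => f (e r).1) =
      -Pi.single (⟨I.card - 1, by omega⟩ : Fin I.card) (1 : ℤ) := by
    funext r
    have hs : (CofSet c I).mulVec (fun r => f (e r).1) r =
        ∑ p ∈ I, if (e r).1 ≤ p then c (e r).1 p * f p else 0 := by
      rw [← Finset.sum_coe_sort I, ← e.toEquiv.sum_comp]
      simp only [Matrix.mulVec, dotProduct, CofSet, Matrix.of_apply]
      apply Finset.sum_congr rfl
      intro s _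
      have : ((r : ℕ) ≤ s) ↔ (e r).1 ≤ (e s).1 := by
        rw [Subtype.coe_le_coe, e.le_iff_le, Fin.le_def]
      simp only [this, ite_mul, zero_mul]
      rfl
    rw [hs]
    have hsplit : ∑ p ∈ I, (if (e r).1 ≤ p then c (e r).1 p * f p else 0) =
        f (e r).1 + ∑ p ∈ I with (e r).1 < p, c (e r).1 p * f p := by
      rw [Finset.sum_filter, ← Finset.add_sum_erase I _ (hmem r),
        ← Finset.add_sum_erase I (fun p => if (e r).1 < p then _ else _) (hmem r)]
      simp only [le_refl, if_true, lt_irrefl, if_false, zero_add, hdiag _ (hmem r), one_mul]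
      congr 1
      apply Finset.sum_congr rfl
      intro p hp
      have := Finset.ne_of_mem_erase hp
      have h2 : (e r).1 ≤ p ↔ (e r).1 < p := by omega
      simp only [h2]
    rw [hsplit]
    by_cases hr : r = ⟨I.card - 1, by omega⟩
    · have hr2 : (e r).1 = j := by rw [hr, hlast]
      rw [hr2, fj]
      rw [Finset.filter_false_of_mem]
      · simp [hr]
      · intro p hp; have := hmax p hp; omega
    · have hlt : (e r).1 < j := by
        apply lt_of_le_of_ne (hmax _ (hmem _))
        intro h
        apply hr
        apply e.injective
        apply Subtype.ext
        rw [h, hlast]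
      rw [hf _ (hmem r) hlt]
      simp [hr]
  have hu : IsUnit (CofSet c I).det := by rw [hdet]; exact isUnit_one
  have h2 := congrArg (fun v => (CofSet c I)⁻¹.mulVec v) hmul
  simp only [Matrix.mulVec_mulVec, Matrix.nonsing_inv_mul _ hu, Matrix.one_mulVec,
    Matrix.mulVec_neg, Matrix.mulVec_single_one] at h2
  have h3 := congrFun h2 ⟨0, hcard⟩
  rw [bottOfSet, dif_pos hcard]
  rw [hfirst] at h3
  rw [h3]
  rfl

theorem bott_beta (k : ℕ) (c : ℕ → ℕ → ℤ) (hc : ∀ i, 1 ≤ i → i ≤ k → c i i = 1)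
    (w : ℕ → Bool) (m j : ℕ) (hm : 1 ≤ m) (hmj : m < j) (hj : j ≤ k) :
    bottOfSet c (insert m (((Finset.Ioo m j).filter fun l => w l = false) ∪ {j})) =
      betaAux c w j m := by
  have hI : ∀ l, l ∈ (insert m (((Finset.Ioo m j).filter fun l => w l = false) ∪ {j})) ↔
      l = m ∨ ((m < l ∧ l < j) ∧ w l = false) ∨ l = j := by
    intro l; simp; tauto
  apply bott_eq c _ m j
  · rw [hI]; tauto
  · rw [hI]; tauto
  · intro l hl; rw [hI] at hl; omega
  · intro l hl; rw [hI] at hl; omega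
  · intro l hl; rw [hI] at hl; apply hc <;> omega
  · exact betaAux_self c w j
  · intro l hl hlj
    rw [hI] at hl
    rw [betaAux_lt c w j l hlj, ← Finset.sum_filter]
    congr 1
    apply Finset.sum_congr _ (fun _ _ => rfl)
    ext p
    rw [Finset.mem_filter, Finset.mem_filter, hI, Finset.mem_Ioc]
    constructor
    · rintro ⟨⟨h1, h2⟩, h3⟩
      refine ⟨?_, h1⟩
      rcases h3 with h3 | h3
      · by_cases p = j
        · tauto
        · right; left; refine ⟨by omega, h3⟩
      · tauto
    · rintro ⟨h1, h2⟩
      rcases h1 with h1 | h1 | h1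
      · omega
      · exact ⟨by omega, Or.inl h1.2⟩
      · exact ⟨by omega, Or.inr h1⟩

theorem key_int (k : ℕ) (c b : ℕ → ℕ → ℤ)
    (hc : ∀ i, 1 ≤ i → i ≤ k → c i i = 1)
    (hbdiag : ∀ i, 1 ≤ i → i ≤ k → b i i = -1)
    (hbzero : ∀ i j, 1 ≤ j → j < i → i ≤ k → b i j = 0)
    (hbrec : ∀ i j, 1 ≤ i → i < j → j ≤ k →
      b i j = -∑ m ∈ Finset.Ioc i j, c i m * b m j)
    (w : ℕ → Bool) (i j : Fin k) (hi : w ((i : ℕ) + 1) = true) :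
    ∑ m : Fin k, b ((i : ℕ) + 1) ((m : ℕ) + 1) *
      (if m = j then -1 else if m < j ∧ w ((m : ℕ) + 1) = true then
        -betaAux c w ((j : ℕ) + 1) ((m : ℕ) + 1) else 0) = if i = j then 1 else 0 := by
  let Bm : Matrix (Fin k) (Fin k) ℤ := Matrix.of fun i j => b ((i : ℕ) + 1) ((j : ℕ) + 1)
  let Cm : Matrix (Fin k) (Fin k) ℤ := Matrix.of fun i j =>
    if (i : ℕ) + 1 ≤ (j : ℕ) + 1 then c ((i : ℕ) + 1) ((j : ℕ) + 1) else 0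
  -- row formula
  have hrow : ∀ (f : ℕ → ℤ) (i : Fin k) (J : ℕ), (i : ℕ) + 1 ≤ J → J ≤ k →
      (∀ l, J < l → l ≤ k → f l = 0) →
      Cm.mulVec (fun m => f ((m : ℕ) + 1)) i = f ((i : ℕ) + 1) +
        ∑ m ∈ Finset.Ioc ((i : ℕ) + 1) J, c ((i : ℕ) + 1) m * f m := by
    intro f i J hiJ hJ hf
    simp only [Matrix.mulVec, dotProduct, Cm, Matrix.of_apply]
    rw [sum_fin_Icc k (fun m => (if (i : ℕ) + 1 ≤ m then c ((i : ℕ) + 1) m else 0) * f m)]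
    have h1 : ∑ m ∈ Finset.Icc ((i : ℕ) + 1) J, c ((i : ℕ) + 1) m * f m =
        f ((i : ℕ) + 1) + ∑ m ∈ Finset.Ioc ((i : ℕ) + 1) J, c ((i : ℕ) + 1) m * f m := by
      rw [← Finset.Ioc_insert_left hiJ, Finset.sum_insert (by simp),
        hc _ (by omega) (by omega), one_mul]
    rw [← h1]
    symm
    apply Finset.sum_subset_zero_on_sdiff
    · intro x; simp only [Finset.mem_Icc]; omega
    · intro x hx
      simp only [Finset.mem_sdiff, Finset.mem_Icc] at hx
      by_cases h : (i : ℕ) + 1 ≤ x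
      · rw [hf x (by omega) (by omega), mul_zero]
      · rw [if_neg h, zero_mul]
    · intro x hx
      rw [if_pos (Finset.mem_Icc.1 hx).1]
  have hrow0 : ∀ (f : ℕ → ℤ) (i : Fin k) (J : ℕ), J < (i : ℕ) + 1 →
      (∀ l, J < l → l ≤ k → f l = 0) →
      Cm.mulVec (fun m => f ((m : ℕ) + 1)) i = 0 := by
    intro f i J hiJ hf
    simp only [Matrix.mulVec, dotProduct, Cm, Matrix.of_apply]
    apply Finset.sum_eq_zero
    intro m _
    by_cases h : (i : ℕ) + 1 ≤ (m : ℕ) + 1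
    · rw [hf _ (by omega) (by omega), mul_zero]
    · rw [if_neg h, zero_mul]
  have hCB : Cm * (-Bm) = 1 := by
    ext p q
    have h0 : (Cm * (-Bm)) p q = -(Cm.mulVec (fun m => b ((m : ℕ) + 1) ((q : ℕ) + 1)) p) := by
      simp [Matrix.mul_apply, Matrix.mulVec, dotProduct, Bm]
    rw [h0]
    have hz : ∀ l, (q : ℕ) + 1 < l → l ≤ k → b l ((q : ℕ) + 1) = 0 :=
      fun l h1 h2 => hbzero _ _ (by omega) h1 h2
    rcases lt_trichotomy p q with h | h | h
    · have h' : (p : ℕ) < q := h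
      rw [hrow (fun m => b m ((q : ℕ) + 1)) p ((q : ℕ) + 1) (by omega) (by omega) hz,
        hbrec _ _ (by omega) (by omega) (by omega), Matrix.one_apply_ne h.ne]
      simp
    · subst h
      rw [hrow (fun m => b m ((p : ℕ) + 1)) p ((p : ℕ) + 1) (by omega) (by omega) hz,
        hbdiag _ (by omega) (by omega)]
      simp
    · have h' : (q : ℕ) < p := h
      rw [hrow0 (fun m => b m ((q : ℕ) + 1)) p ((q : ℕ) + 1) (by omega) hz,
        Matrix.one_apply_ne h.ne']
      simp
  have hBC : (-Bm) * Cm = 1 := mul_eq_one_comm.1 hCB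
  let v0 : ℕ → ℤ := fun l => if l ≤ (j : ℕ) + 1 then
    (if w l = false ∨ l = (j : ℕ) + 1 then betaAux c w ((j : ℕ) + 1) l else 0) else 0
  have hv0 : ∀ l, (j : ℕ) + 1 < l → l ≤ k → v0 l = 0 := by
    intro l h1 _; simp only [v0]; rw [if_neg (by omega)]
  have hCv : Cm.mulVec (fun m => v0 ((m : ℕ) + 1)) = fun m =>
      (if m = j then -1 else if m < j ∧ w ((m : ℕ) + 1) = true then
        -betaAux c w ((j : ℕ) + 1) ((m : ℕ) + 1) else 0) := by
    funext m
    rcases lt_trichotomy m j with h | h | h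
    · have h' : (m : ℕ) < j := h
      rw [hrow v0 m ((j : ℕ) + 1) (by omega) (by omega) hv0]
      have hs : ∑ p ∈ Finset.Ioc ((m : ℕ) + 1) ((j : ℕ) + 1), c ((m : ℕ) + 1) p * v0 p =
          -betaAux c w ((j : ℕ) + 1) ((m : ℕ) + 1) := by
        rw [betaAux_lt c w _ _ (by omega : (m : ℕ) + 1 < (j : ℕ) + 1), neg_neg]
        apply Finset.sum_congr rfl
        intro p hp
        simp only [v0]
        rw [if_pos (Finset.mem_Ioc.1 hp).2, mul_ite, mul_zero]
      rw [hs]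
      simp only [v0]
      rw [if_pos (by omega), if_neg h.ne]
      have hne : (m : ℕ) + 1 ≠ (j : ℕ) + 1 := by omega
      cases hw : w ((m : ℕ) + 1) <;> simp [h, h'.ne]
    · subst h
      rw [hrow v0 m ((m : ℕ) + 1) (by omega) (by omega) hv0]
      simp [v0, betaAux_self]
    · have h' : (j : ℕ) < m := h
      rw [hrow0 v0 m ((j : ℕ) + 1) (by omega) hv0, if_neg h.ne', if_neg]
      intro h2; exact absurd h2.1 h.not_gt
  have hfin := congrArg (fun v => (-Bm).mulVec v) hCv
  simp only [Matrix.mulVec_mulVec, hBC, Matrix.one_mulVec] at hfin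
  have hfi := congrFun hfin i
  rw [Matrix.neg_mulVec] at hfi
  have hfi2 : (Bm.mulVec fun m =>
      (if m = j then -1 else if m < j ∧ w ((m : ℕ) + 1) = true then
        -betaAux c w ((j : ℕ) + 1) ((m : ℕ) + 1) else 0)) i = -v0 ((i : ℕ) + 1) := by
    rw [hfi]; simp
  refine Eq.trans hfi2 ?_
  by_cases hij : i = j
  · subst hij; simp [v0, betaAux_self]
  · have : (i : ℕ) ≠ j := fun h => hij (Fin.ext h)
    simp [v0, hij, hi, this]

theorem pairing (k : ℕ) (c b : ℕ → ℕ → ℤ)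
    (hc : ∀ i, 1 ≤ i → i ≤ k → c i i = 1)
    (hbdiag : ∀ i, 1 ≤ i → i ≤ k → b i i = -1)
    (hbzero : ∀ i j, 1 ≤ j → j < i → i ≤ k → b i j = 0)
    (hbrec : ∀ i j, 1 ≤ i → i < j → j ≤ k →
      b i j = -∑ m ∈ Finset.Ioc i j, c i m * b m j)
    (w : ℕ → Bool) (i j : Fin k) :
    ∑ m : Fin k, aVec b w ((i : ℕ) + 1) ((m : ℕ) + 1) *
      upsilonVec c w ((j : ℕ) + 1) ((m : ℕ) + 1) = if i = j then 1 else 0 := by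
  have hups : ∀ m : Fin k, upsilonVec c w ((j : ℕ) + 1) ((m : ℕ) + 1) =
      (if w ((j : ℕ) + 1) then (-1 : ℝ) else 1) * -(((if m = j then -1 else
        if m < j ∧ w ((m : ℕ) + 1) = true then
        -betaAux c w ((j : ℕ) + 1) ((m : ℕ) + 1) else 0 : ℤ)) : ℝ) := by
    intro m
    unfold upsilonVec
    congr 1
    rcases lt_trichotomy m j with h | h | h
    · have h' : (m : ℕ) < j := h
      rw [bott_beta k c hc w _ _ (by omega) (by omega) (by omega)]
      cases hw : w ((m : ℕ) + 1) <;> simp [h, h'.ne, h.ne]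
    · subst h; simp
    · have h' : (j : ℕ) < m := h
      simp [h.ne', h'.ne', h.not_gt]
  cases hi : w ((i : ℕ) + 1)
  · rw [Finset.sum_eq_single i]
    · simp only [aVec, hi, hups i]
      by_cases hij : i = j
      · subst hij; simp [hi]
      · simp [hij]
    · intro m _ hm
      have : (m : ℕ) ≠ i := fun h => hm (Fin.ext h)
      simp [aVec, hi, this]
    · simp
  · have hk := key_int k c b hc hbdiag hbzero hbrec w i j hi
    have hk' := congrArg (fun z : ℤ => (z : ℝ)) hk
    simp only [Int.cast_sum, Int.cast_mul] at hk'
    have : ∀ m : Fin k, aVec b w ((i : ℕ) + 1) ((m : ℕ) + 1) *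
        upsilonVec c w ((j : ℕ) + 1) ((m : ℕ) + 1) =
        (-(if w ((j : ℕ) + 1) then (-1 : ℝ) else 1)) *
        ((b ((i : ℕ) + 1) ((m : ℕ) + 1) : ℝ) * (((if m = j then -1 else
        if m < j ∧ w ((m : ℕ) + 1) = true then
        -betaAux c w ((j : ℕ) + 1) ((m : ℕ) + 1) else 0 : ℤ)) : ℝ)) := by
      intro m
      rw [hups m]
      simp only [aVec, hi, if_true]
      ring
    rw [Finset.sum_congr rfl (fun m _ => this m), ← Finset.mul_sum, hk']
    by_cases hij : i = j
    · subst hij; simp [hi]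
    · simp [hij]

/-- the dual cone of `σ(w) = {∑_j λ_j a_{j,w_j} : λ_j ≥ 0} ⊆ ℝ^k`
is exactly the cone `{∑_j μ_j υ_{j,w_j} : μ_j ≥ 0}`. -/
theorem dual_cone_sigma_eq (k : ℕ) (hk : 1 ≤ k) (c b : ℕ → ℕ → ℤ)
    (hc : ∀ i, 1 ≤ i → i ≤ k → c i i = 1)
    (hbdiag : ∀ i, 1 ≤ i → i ≤ k → b i i = -1)
    (hbzero : ∀ i j, 1 ≤ j → j < i → i ≤ k → b i j = 0)
    (hbrec : ∀ i j, 1 ≤ i → i < j → j ≤ k →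
      b i j = -∑ m ∈ Finset.Ioc i j, c i m * b m j)
    (w : ℕ → Bool) :
    {x : Fin k → ℝ |
        ∀ y ∈ {y : Fin k → ℝ | ∃ lam : Fin k → ℝ, (∀ j, 0 ≤ lam j) ∧
          y = ∑ j : Fin k, lam j • (fun m : Fin k => aVec b w ((j : ℕ) + 1) ((m : ℕ) + 1))},
        0 ≤ ∑ m : Fin k, x m * y m} =
      {x : Fin k → ℝ | ∃ mu : Fin k → ℝ, (∀ j, 0 ≤ mu j) ∧
        x = ∑ j : Fin k, mu j • (fun m : Fin k => upsilonVec c w ((j : ℕ) + 1) ((m : ℕ) + 1))} := by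
  let A : Matrix (Fin k) (Fin k) ℝ := Matrix.of fun j m => aVec b w ((j : ℕ) + 1) ((m : ℕ) + 1)
  let U : Matrix (Fin k) (Fin k) ℝ :=
    Matrix.of fun j m => upsilonVec c w ((j : ℕ) + 1) ((m : ℕ) + 1)
  have hAU : A * U.transpose = 1 := by
    ext i j
    rw [Matrix.mul_apply, Matrix.one_apply]
    exact pairing k c b hc hbdiag hbzero hbrec w i j
  have hUA : U.transpose * A = 1 := mul_eq_one_comm.1 hAU
  have hcomb : ∀ (M : Matrix (Fin k) (Fin k) ℝ) (l : Fin k → ℝ),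
      ∑ j : Fin k, l j • (fun m : Fin k => M j m) = M.transpose.mulVec l := by
    intro M l
    funext m
    simp [Matrix.mulVec, dotProduct, Finset.sum_apply, mul_comm]
  have hA : ∀ l : Fin k → ℝ, ∑ j : Fin k, l j •
      (fun m : Fin k => aVec b w ((j : ℕ) + 1) ((m : ℕ) + 1)) = A.transpose.mulVec l := hcomb A
  have hU : ∀ l : Fin k → ℝ, ∑ j : Fin k, l j •
      (fun m : Fin k => upsilonVec c w ((j : ℕ) + 1) ((m : ℕ) + 1)) = U.transpose.mulVec l :=
    hcomb U
  have hdot : ∀ x l : Fin k → ℝ, ∑ m : Fin k, x m * (A.transpose.mulVec l) m =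
      ∑ j : Fin k, (A.mulVec x) j * l j := by
    intro x l
    change x ⬝ᵥ (A.transpose.mulVec l) = (A.mulVec x) ⬝ᵥ l
    rw [Matrix.dotProduct_mulVec, Matrix.vecMul_transpose]
  ext x
  simp only [Set.mem_setOf_eq, hA, hU]
  constructor
  · intro h
    refine ⟨A.mulVec x, ?_, ?_⟩
    · intro j
      have h1 := h _ ⟨Pi.single j 1, fun i => ?_, rfl⟩
      · rw [hdot] at h1
        simpa [Pi.single_apply] using h1
      · rw [Pi.single_apply]; split_ifs <;> norm_num
    · rw [Matrix.mulVec_mulVec, hUA, Matrix.one_mulVec]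
  · rintro ⟨mu, hmu, rfl⟩ y ⟨lam, hlam, rfl⟩
    rw [hdot, Matrix.mulVec_mulVec, hAU, Matrix.one_mulVec]
    exact Finset.sum_nonneg fun j _ => mul_nonneg (hmu j) (hlam j)
end

section
/- Let n ≥ 1. For (x,y) = (x_1,y_1;…;x_n,y_n) ∈ (ℂ²∖0)^n (so (x_j,y_j) ≠ (0,0) for all j), define vectors l_{n+1} := ω_{n+1} and l_j := x_j ω_j + y_j l_{j+1} for j = n, n-1, …, 1, and define U(x,y) to be the flag with i-th subspace U(x,y)_i := ℂ_{[i-1]} + ℂ l_i. Then U(x,y) is a bounded flag in ℂ^{n+1}, and moreover every bounded flag in ℂ^{n+1} equals U(x,y) for some (x,y) ∈ (ℂ²∖0)^n. -/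
/-- `ℂ_{[j]}`: the coordinate subspace of `ℂ^{n+1}` spanned by the first `j` standard
basis vectors `ω_1, …, ω_j` (0-based indices `0, …, j-1`). -/
noncomputable def stdSub (n j : ℕ) : Submodule ℂ (Fin (n + 1) → ℂ) :=
  Submodule.span ℂ {v | ∃ i : Fin (n + 1), (i : ℕ) < j ∧ v = Pi.single i 1}

/-- Auxiliary descending recursion: `lAux n x y m = l_{n+1-m}`, where `l_{n+1} = ω_{n+1}`
and `l_j = x_j ω_j + y_j l_{j+1}`. -/
noncomputable def lAux (n : ℕ) (x y : ℕ → ℂ) : ℕ → (Fin (n + 1) → ℂ)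
  | 0 => Pi.single (Fin.last n) 1
  | m + 1 => x (n - m) • (Pi.single (⟨n - m - 1, by omega⟩ : Fin (n + 1)) 1 : Fin (n + 1) → ℂ) + y (n - m) • lAux n x y m

/-- The vector `l_j` (`1 ≤ j ≤ n+1`), defined by `l_{n+1} = ω_{n+1}`,
`l_j = x_j ω_j + y_j l_{j+1}`. -/
noncomputable def lvec (n : ℕ) (x y : ℕ → ℂ) (j : ℕ) : Fin (n + 1) → ℂ :=
  lAux n x y (n + 1 - j)

/-- The `i`-th subspace `U(x,y)_i = ℂ_{[i-1]} + ℂ l_i` of the flag `U(x,y)`. -/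
noncomputable def flagOf (n : ℕ) (x y : ℕ → ℂ) (i : ℕ) : Submodule ℂ (Fin (n + 1) → ℂ) :=
  stdSub n (i - 1) ⊔ Submodule.span ℂ {lvec n x y i}

theorem mem_stdSub_zero {n j : ℕ} {v : Fin (n+1) → ℂ} (hv : v ∈ stdSub n j) (i : Fin (n+1))
    (hi : j ≤ i) : v i = 0 := by
  unfold stdSub at hv
  induction hv using Submodule.span_induction with
  | mem x hx =>
    obtain ⟨k, hk, rfl⟩ := hx
    apply Pi.single_eq_of_ne
    rintro rfl
    omega
  | zero => rfl
  | add a b _ _ ha hb => simp [ha, hb]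
  | smul c a _ ha => simp [ha]

theorem stdSub_mono {n j k : ℕ} (h : j ≤ k) : stdSub n j ≤ stdSub n k := by
  apply Submodule.span_mono
  rintro v ⟨i, hi, rfl⟩
  exact ⟨i, by omega, rfl⟩

theorem single_mem_stdSub {n j : ℕ} (i : Fin (n+1)) (h : (i : ℕ) < j) :
    (Pi.single i 1 : Fin (n+1) → ℂ) ∈ stdSub n j :=
  Submodule.subset_span ⟨i, h, rfl⟩

theorem stdSub_succ {n j : ℕ} (h : j < n + 1) :
    stdSub n (j+1) = stdSub n j ⊔ Submodule.span ℂ {(Pi.single (⟨j, h⟩ : Fin (n+1)) 1 : Fin (n+1) → ℂ)} := by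
  apply le_antisymm
  · apply Submodule.span_le.2
    rintro v ⟨i, hi, rfl⟩
    by_cases hij : (i : ℕ) < j
    · exact Submodule.mem_sup_left (single_mem_stdSub i hij)
    · apply Submodule.mem_sup_right
      have : i = ⟨j, h⟩ := Fin.ext (by simp; omega)
      rw [this]
      exact Submodule.mem_span_singleton_self _
  · apply sup_le (stdSub_mono (by omega))
    rw [Submodule.span_singleton_le_iff_mem]
    exact single_mem_stdSub _ (by simp)

theorem finrank_sup_single {n : ℕ} (S : Submodule ℂ (Fin (n+1) → ℂ)) (v : Fin (n+1) → ℂ)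
    (hv : v ∉ S) : Module.finrank ℂ (S ⊔ Submodule.span ℂ {v} : Submodule ℂ (Fin (n+1) → ℂ)) = Module.finrank ℂ S + 1 := by
  have h0 : v ≠ 0 := by rintro rfl; exact hv S.zero_mem
  have hd : S ⊓ Submodule.span ℂ {v} = ⊥ :=
    disjoint_iff.1 ((Submodule.disjoint_span_singleton' h0).2 hv)
  have := Submodule.finrank_sup_add_finrank_inf_eq S (Submodule.span ℂ {v})
  rw [hd, finrank_bot, finrank_span_singleton h0] at this
  simpa using this

theorem finrank_stdSub {n j : ℕ} (h : j ≤ n + 1) : Module.finrank ℂ (stdSub n j) = j := by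
  induction j with
  | zero =>
    have : stdSub n 0 = ⊥ := by simp [stdSub]
    rw [this, finrank_bot]
  | succ j ih =>
    rw [stdSub_succ (by omega), finrank_sup_single, ih (by omega)]
    intro hm
    have := mem_stdSub_zero hm ⟨j, by omega⟩ (le_refl _)
    simp at this

theorem lvec_last (n : ℕ) (x y : ℕ → ℂ) : lvec n x y (n+1) = Pi.single (Fin.last n) 1 := by
  simp [lvec, lAux]

theorem lvec_rec {n j : ℕ} (x y : ℕ → ℂ) (hj : j + 1 ≤ n) :
    lvec n x y (j+1) = x (j+1) • (Pi.single (⟨j, by omega⟩ : Fin (n+1)) 1 : Fin (n+1) → ℂ)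
      + y (j+1) • lvec n x y (j+2) := by
  have h1 : n + 1 - (j+1) = (n + 1 - (j+2)) + 1 := by omega
  have h2 : n - (n + 1 - (j+2)) = j + 1 := by omega
  unfold lvec
  rw [h1, lAux]
  simp only [h2, Nat.add_sub_cancel]

theorem lvec_zero {n : ℕ} (x y : ℕ → ℂ) (m : ℕ) : ∀ j, j + m = n → ∀ i : Fin (n+1), (i : ℕ) < j →
    lvec n x y (j+1) i = 0 := by
  induction m with
  | zero =>
    intro j hj i hi
    obtain rfl : j = n := by omega
    rw [lvec_last]
    apply Pi.single_eq_of_ne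
    rintro rfl
    simp at hi
  | succ m ih =>
    intro j hj i hi
    rw [lvec_rec x y (by omega)]
    have h1 := ih (j+1) (by omega) i (by omega)
    have h2 : (Pi.single (⟨j, by omega⟩ : Fin (n+1)) 1 : Fin (n+1) → ℂ) i = 0 := by
      apply Pi.single_eq_of_ne
      intro he
      have := congrArg Fin.val he
      simp at this
      omega
    simp only [Pi.add_apply, Pi.smul_apply, h1, h2, smul_zero, add_zero]

theorem lvec_notMem {n : ℕ} (x y : ℕ → ℂ) (m : ℕ) : ∀ j, j + m = n →
    (∀ k, j + 1 ≤ k → k ≤ n → ¬(x k = 0 ∧ y k = 0)) → lvec n x y (j+1) ∉ stdSub n j := by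
  induction m with
  | zero =>
    intro j hj _ hm
    obtain rfl : j = n := by omega
    rw [lvec_last] at hm
    have := mem_stdSub_zero hm (Fin.last _) (by simp)
    simp at this
  | succ m ih =>
    intro j hj hxy hm
    have hz : lvec n x y (j+2) (⟨j, by omega⟩ : Fin (n+1)) = 0 :=
      lvec_zero x y m (j+1) (by omega) _ (by simp)
    have hn := ih (j+1) (by omega) (fun k hk => hxy k (by omega))
    rw [lvec_rec x y (by omega)] at hm
    have h := mem_stdSub_zero hm ⟨j, by omega⟩ (le_refl _)
    have hx : x (j+1) = 0 := by
      simpa only [Pi.add_apply, Pi.smul_apply, hz, smul_zero, add_zero, Pi.single_eq_same,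
        smul_eq_mul, mul_one, mul_zero] using h
    have hy : y (j+1) ≠ 0 := fun hy => hxy (j+1) le_rfl (by omega) ⟨hx, hy⟩
    rw [hx, zero_smul, zero_add] at hm
    exact hn (stdSub_mono (by omega) (((stdSub n j).smul_mem_iff hy).1 hm))

theorem finrank_flagOf {n j : ℕ} (x y : ℕ → ℂ) (hj : j ≤ n)
    (hxy : ∀ k, j + 1 ≤ k → k ≤ n → ¬(x k = 0 ∧ y k = 0)) :
    Module.finrank ℂ (flagOf n x y (j+1)) = j + 1 := by
  unfold flagOf
  rw [finrank_sup_single, Nat.add_sub_cancel, finrank_stdSub (by omega)]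
  exact lvec_notMem x y (n - j) j (by omega) hxy

theorem lvec_congr {n : ℕ} (x y x' y' : ℕ → ℂ) (m : ℕ) : ∀ j, j + m = n →
    (∀ k, j + 1 ≤ k → x k = x' k ∧ y k = y' k) → lvec n x y (j+1) = lvec n x' y' (j+1) := by
  induction m with
  | zero =>
    intro j hj _
    obtain rfl : j = n := by omega
    rw [lvec_last, lvec_last]
  | succ m ih =>
    intro j hj h
    rw [lvec_rec x y (by omega), lvec_rec x' y' (by omega), ih (j+1) (by omega)
      (fun k hk => h k (by omega)), (h (j+1) le_rfl).1, (h (j+1) le_rfl).2]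

theorem flagOf_le {n j : ℕ} (x y : ℕ → ℂ) (hj : j + 1 ≤ n) :
    flagOf n x y (j+1) ≤ flagOf n x y (j+2) := by
  unfold flagOf
  apply sup_le (le_sup_of_le_left (stdSub_mono (by omega)))
  rw [Submodule.span_singleton_le_iff_mem, lvec_rec x y hj]
  apply Submodule.add_mem
  · exact Submodule.mem_sup_left (Submodule.smul_mem _ _ (single_mem_stdSub _ (by simp)))
  · exact Submodule.mem_sup_right (Submodule.smul_mem _ _ (Submodule.mem_span_singleton_self _))

theorem flag_surj {n : ℕ} (U : ℕ → Submodule ℂ (Fin (n + 1) → ℂ))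
    (hd : ∀ i, 1 ≤ i → i ≤ n → Module.finrank ℂ (U i) = i)
    (hlt : ∀ i, 1 ≤ i → i < n → U i < U (i + 1))
    (hb : ∀ i, 1 ≤ i → i ≤ n → stdSub n (i - 1) ≤ U i) (m : ℕ) : ∀ j, j + m = n →
    ∃ x y : ℕ → ℂ, (∀ k, j + 1 ≤ k → k ≤ n → ¬(x k = 0 ∧ y k = 0)) ∧
        ∀ i, j + 1 ≤ i → i ≤ n → U i = flagOf n x y i := by
  induction m with
  | zero =>
    rintro j rfl
    exact ⟨0, 0, fun k hk hk' => by omega, fun k hk hk' => by omega⟩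
  | succ m ih =>
    intro j hj
    obtain ⟨x, y, hxy, hU⟩ := ih (j+1) (by omega)
    have hle : U (j+1) ≤ flagOf n x y (j+2) := by
      by_cases hjn : j + 1 = n
      · have : flagOf n x y (j+2) = ⊤ := by
          apply Submodule.eq_top_of_finrank_eq
          rw [finrank_flagOf x y (by omega) hxy]
          simp [hjn]
        rw [this]; exact le_top
      · rw [← hU (j+2) le_rfl (by omega)]
        exact (hlt (j+1) (by omega) (by omega)).le
    have hS : stdSub n j ≤ U (j+1) := hb (j+1) (by omega) (by omega)
    have hUd := hd (j+1) (by omega) (by omega)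
    have hSd := finrank_stdSub (n := n) (j := j) (by omega)
    obtain ⟨u, huU, huS⟩ : ∃ u ∈ U (j+1), u ∉ stdSub n j := by
      by_contra! hcon
      have := Submodule.finrank_mono (show U (j+1) ≤ stdSub n j from hcon)
      omega
    have hu := hle huU
    unfold flagOf at hu
    rw [show j + 2 - 1 = j + 1 from rfl, stdSub_succ (by omega)] at hu
    obtain ⟨w, hw, c, hc, rfl⟩ := Submodule.mem_sup.1 hu
    obtain ⟨s, hs, d, hd', rfl⟩ := Submodule.mem_sup.1 hw
    obtain ⟨b, rfl⟩ := Submodule.mem_span_singleton.1 hc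
    obtain ⟨a, rfl⟩ := Submodule.mem_span_singleton.1 hd'
    have hc1 : ∀ k, j + 2 ≤ k → Function.update x (j+1) a k = x k ∧
        Function.update y (j+1) b k = y k := fun k hk =>
      ⟨Function.update_of_ne (by omega) _ _, Function.update_of_ne (by omega) _ _⟩
    have hxy' : ∀ k, j + 1 ≤ k → k ≤ n → ¬(Function.update x (j+1) a k = 0 ∧
        Function.update y (j+1) b k = 0) := by
      intro k hk hkn
      by_cases hkj : k = j + 1
      · subst hkj
        rw [Function.update_self, Function.update_self]
        rintro ⟨rfl, rfl⟩
        apply huS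
        simpa using hs
      · rw [(hc1 k (by omega)).1, (hc1 k (by omega)).2]
        exact hxy k (by omega) hkn
    refine ⟨Function.update x (j+1) a, Function.update y (j+1) b, hxy', ?_⟩
    intro i hi hin
    by_cases hij : i = j + 1
    · subst hij
      symm
      apply Submodule.eq_of_le_of_finrank_eq
      · unfold flagOf
        apply sup_le hS
        rw [Submodule.span_singleton_le_iff_mem, lvec_rec _ _ hin, Function.update_self,
          Function.update_self, lvec_congr _ _ x y m (j+1) (by omega) hc1]
        have := Submodule.sub_mem _ huU (hS hs)
        rwa [add_assoc, add_sub_cancel_left] at this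
      · rw [finrank_flagOf _ _ (by omega) hxy', hUd]
    · rw [hU i (by omega) hin]
      obtain ⟨i, rfl⟩ : ∃ i', i = i' + 1 := ⟨i - 1, by omega⟩
      unfold flagOf
      rw [lvec_congr _ _ x y (n - i) i (by omega) (fun k hk => hc1 k (by omega))]

/-- for every `(x,y) ∈ (ℂ²∖0)^n` the flag `U(x,y)` with
`U(x,y)_i = ℂ_{[i-1]} + ℂ l_i` is a bounded flag in `ℂ^{n+1}`, and conversely every
bounded flag in `ℂ^{n+1}` equals `U(x,y)` for some `(x,y) ∈ (ℂ²∖0)^n`. -/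
theorem flagOf_bounded_and_surjective (n : ℕ) (hn : 1 ≤ n) :
    (∀ x y : ℕ → ℂ, (∀ j, 1 ≤ j → j ≤ n → ¬(x j = 0 ∧ y j = 0)) →
      (∀ i, 1 ≤ i → i ≤ n → Module.finrank ℂ (flagOf n x y i) = i) ∧
      (∀ i, 1 ≤ i → i < n → flagOf n x y i < flagOf n x y (i + 1)) ∧
      (∀ i, 1 ≤ i → i ≤ n → stdSub n (i - 1) ≤ flagOf n x y i)) ∧
    (∀ U : ℕ → Submodule ℂ (Fin (n + 1) → ℂ),
      (∀ i, 1 ≤ i → i ≤ n → Module.finrank ℂ (U i) = i) →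
      (∀ i, 1 ≤ i → i < n → U i < U (i + 1)) →
      (∀ i, 1 ≤ i → i ≤ n → stdSub n (i - 1) ≤ U i) →
      ∃ x y : ℕ → ℂ, (∀ j, 1 ≤ j → j ≤ n → ¬(x j = 0 ∧ y j = 0)) ∧
        ∀ i, 1 ≤ i → i ≤ n → U i = flagOf n x y i) := by
  refine ⟨fun x y hxy => ⟨?_, ?_, ?_⟩, ?_⟩
  · intro i hi hin
    obtain ⟨i, rfl⟩ : ∃ i', i = i' + 1 := ⟨i - 1, by omega⟩
    exact finrank_flagOf x y (by omega) (fun k hk => hxy k (by omega))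
  · intro i hi hin
    obtain ⟨i, rfl⟩ : ∃ i', i = i' + 1 := ⟨i - 1, by omega⟩
    refine lt_of_le_of_ne (flagOf_le x y hin.le) (fun he => ?_)
    have h1 := finrank_flagOf (n := n) (j := i) x y (by omega) (fun k hk => hxy k (by omega))
    have h2 := finrank_flagOf (n := n) (j := i + 1) x y (by omega) (fun k hk => hxy k (by omega))
    rw [he] at h1
    omega
  · intro i hi hin
    exact le_sup_left
  · intro U hd hlt hb
    obtain ⟨x, y, h1, h2⟩ := flag_surj U hd hlt hb n 0 (by omega)
    exact ⟨x, y, h1, h2⟩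
end
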